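/- Let d be a natural number and fix a format n : Fin d → ℕ. If f is a function from d-way complex tensors of format n to the nonnegative reals such that f(σT) = f(T) for every tensor T and every field automorphism σ of ℂ (applied entrywise to T), then the range of f is a countable set. -/

import Mathlib

open Cardinal in
/-- Two uncountable algebraically closed extensions of equal cardinality of a countable ring `R`
are isomorphic as `R`-algebras. -/
theorem IsAlgClosed.nonempty_algEquiv_of_countable.{u, v, w} {R : Type u} {K : Type v} {L : Type w}
    [CommRing R] [Countable R] [Field K] [Field L] [IsAlgClosed K] [IsAlgClosed L]
    [Algebra R K] [Algebra R L] [FaithfulSMul R K] [FaithfulSMul R L] (hK : ℵ₀ < #K) (hKL : Nonempty (K ≃ L)) :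
    Nonempty (K ≃ₐ[R] L) := by
  have : Nontrivial R := RingHom.domain_nontrivial (algebraMap R K)
  obtain ⟨s, hs⟩ := exists_isTranscendenceBasis R K
  obtain ⟨t, ht⟩ := exists_isTranscendenceBasis R L
  have hL : ℵ₀ < #L := by
    rwa [← aleph0_lt_lift, ← lift_mk_eq'.2 hKL, aleph0_lt_lift]
  have hst : Cardinal.lift.{w} #s = Cardinal.lift.{v} #t := by
    rw [← Cardinal.lift_injective (cardinal_eq_cardinal_transcendence_basis_of_aleph0_lt _
        hs mk_le_aleph0 hK),
      ← Cardinal.lift_injective (cardinal_eq_cardinal_transcendence_basis_of_aleph0_lt _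
        ht mk_le_aleph0 hL)]
    exact lift_mk_eq'.2 hKL
  obtain ⟨e⟩ := lift_mk_eq'.1 hst
  let := isAlgClosure_of_transcendence_basis _ hs
  let := isAlgClosure_of_transcendence_basis _ ht
  let ε : Algebra.adjoin R (Set.range ((↑) : s → K)) ≃ₐ[R]
      Algebra.adjoin R (Set.range ((↑) : t → L)) :=
    hs.1.aevalEquiv.symm.trans ((MvPolynomial.renameEquiv R e).trans ht.1.aevalEquiv)
  refine ⟨AlgEquiv.ofRingEquiv (f := IsAlgClosure.equivOfEquiv K L ε.toRingEquiv) fun r ↦ ?_⟩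
  rw [IsScalarTower.algebraMap_apply R (Algebra.adjoin R (Set.range ((↑) : s → K))) K,
    IsAlgClosure.equivOfEquiv_algebraMap,
    IsScalarTower.algebraMap_apply R (Algebra.adjoin R (Set.range ((↑) : t → L))) L]
  exact congrArg _ (ε.commutes r)

open Cardinal in
/-- Two homomorphisms with the same kernel from a countable ring to an uncountable algebraically
closed field differ by an automorphism of the field. -/
theorem IsAlgClosed.exists_ringEquiv_comp_eq_of_ker_eq {A K : Type*} [CommRing A] [Countable A]
    [Field K] [IsAlgClosed K] (hK : ℵ₀ < #K) (φ ψ : A →+* K)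
    (h : RingHom.ker φ = RingHom.ker ψ) : ∃ σ : K ≃+* K, ∀ a, σ (φ a) = ψ a := by
  let φ' : A ⧸ RingHom.ker φ →+* K := RingHom.kerLift φ
  let ψ' : A ⧸ RingHom.ker φ →+* K := Ideal.Quotient.lift _ ψ fun a ha ↦ by rwa [h] at ha
  have hφ : Function.Injective φ' := RingHom.kerLift_injective φ
  have hψ : Function.Injective ψ' := RingHom.lift_injective_of_ker_le_ideal _ _ h.ge
  have : Countable (A ⧸ RingHom.ker φ) := Ideal.Quotient.mk_surjective.countable
  obtain ⟨σ⟩ := @nonempty_algEquiv_of_countable (A ⧸ RingHom.ker φ) K K _ _ _ _ _ _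
    φ'.toAlgebra ψ'.toAlgebra
    (@faithfulSMul_iff_algebraMap_injective _ _ _ _ φ'.toAlgebra |>.2 hφ)
    (@faithfulSMul_iff_algebraMap_injective _ _ _ _ ψ'.toAlgebra |>.2 hψ) hK ⟨Equiv.refl K⟩
  exact ⟨@AlgEquiv.toRingEquiv _ _ _ _ _ _ φ'.toAlgebra ψ'.toAlgebra σ, fun a ↦
    @AlgEquiv.commutes _ _ _ _ _ _ φ'.toAlgebra ψ'.toAlgebra σ (Ideal.Quotient.mk _ a)⟩

/-- A countable Noetherian ring has only countably many ideals. -/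
theorem Ideal.countable_of_isNoetherianRing (A : Type*) [CommRing A] [Countable A]
    [IsNoetherianRing A] : Countable (Ideal A) := by
  have : Function.Surjective fun s : Finset A ↦ Ideal.span (s : Set A) :=
    fun I ↦ IsNoetherian.noetherian I
  exact this.countable

open Cardinal in
theorem MvPolynomial.countable_of_countable (ι R : Type*) [CommSemiring R] [Countable ι]
    [Countable R] : Countable (MvPolynomial ι R) := by
  rw [← mk_le_aleph0_iff]
  exact cardinalMk_le_max_lift.trans (by simp)

/-- If `f` is a function from `d`-way complex tensors of format `n` to the
nonnegative reals that is invariant under applying any field automorphism of `ℂ`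
entrywise, then the range of `f` is countable. -/
theorem countable_range_of_algebraic_invariant (d : ℕ) (n : Fin d → ℕ)
    (f : (((i : Fin d) → Fin (n i)) → ℂ) → NNReal)
    (hf : ∀ (T : ((i : Fin d) → Fin (n i)) → ℂ) (σ : ℂ ≃+* ℂ),
      f (fun α => σ (T α)) = f T) :
    (Set.range f).Countable := by
  let ι := (i : Fin d) → Fin (n i)
  have : Countable (MvPolynomial ι ℤ) := MvPolynomial.countable_of_countable ι ℤ
  have : Countable (Ideal (MvPolynomial ι ℤ)) := Ideal.countable_of_isNoetherianRing _
  let κ : (ι → ℂ) → Ideal (MvPolynomial ι ℤ) := fun T ↦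
    RingHom.ker (MvPolynomial.aeval T : MvPolynomial ι ℤ →ₐ[ℤ] ℂ).toRingHom
  have hκ : Function.FactorsThrough f κ := fun T T' h ↦ by
    obtain ⟨σ, hσ⟩ := IsAlgClosed.exists_ringEquiv_comp_eq_of_ker_eq
      (Cardinal.mk_complex ▸ Cardinal.aleph0_lt_continuum) _ _ h
    have hT : (fun α ↦ σ (T α)) = T' := funext fun α ↦ by simpa using hσ (MvPolynomial.X α)
    rw [← hf T σ, hT]
  refine (Set.countable_range (Function.extend κ f 0)).mono ?_
  rintro _ ⟨T, rfl⟩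
  exact ⟨κ T, hκ.extend_apply _ _⟩
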